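/- Let T > 0, n ∈ ℕ+, h = T/n, σ, X₀ ∈ ℝ, let B : [0,T] → ℝ be continuous with B(0) = 0, and let a : ℝ → ℝ be Lipschitz with constant L. Let X : [0,T] → ℝ be continuous with X(t) = X₀ + ∫_0^t a(X(s)) ds + σ B(t) for all t, and let Y : [0,T] → ℝ be the continuous Euler interpolation, i.e. Y(t) = X₀ + ∫_0^t a(Y(⌊s⌋)) ds + σ B(t) for all t ∈ [0,T]. Then sup_{t ∈ [0,T]} |X(t) − Y(t)| ≤ e^{LT} · sup_{t ∈ [0,T]} | ∫_0^t ( a(X(s)) − a(X(⌊s⌋)) ) ds |. -/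

import Mathlib

/-- The grid point `⌊t⌋`: for `t ∈ (kh, (k+1)h]` it equals `kh`, and `⌊t⌋ = 0` for `t ≤ 0`. -/
noncomputable def gridFloor (h t : ℝ) : ℝ :=
  if t ≤ 0 then 0 else (↑(⌈t / h⌉ - 1) : ℝ) * h

theorem gridFloor_mem_aux {h s : ℝ} (hh : 0 < h) (hs : 0 ≤ s) :
    0 ≤ gridFloor h s ∧ gridFloor h s ≤ s := by
  unfold gridFloor
  split_ifs with h0
  · exact ⟨le_rfl, hs⟩
  · have hs' : 0 < s := not_le.mp h0
    have h1 : (0 : ℤ) < ⌈s / h⌉ := Int.ceil_pos.mpr (div_pos hs' hh)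
    have h2 : (0 : ℝ) ≤ ((⌈s / h⌉ - 1 : ℤ) : ℝ) := by
      exact_mod_cast (by omega : (0 : ℤ) ≤ ⌈s / h⌉ - 1)
    refine ⟨mul_nonneg h2 hh.le, ?_⟩
    have h3 : (⌈s / h⌉ : ℝ) < s / h + 1 := Int.ceil_lt_add_one _
    rw [← le_div_iff₀ hh]
    push_cast
    linarith

theorem gridFloor_le_aux {h s : ℝ} (k : ℕ) (hh : 0 < h) (hs : s ≤ (k + 1 : ℕ) * h) :
    gridFloor h s ≤ k * h := by
  unfold gridFloor
  split_ifs with h0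
  · positivity
  · have h1 : ⌈s / h⌉ ≤ ((k + 1 : ℕ) : ℤ) := by
      rw [Int.ceil_le, div_le_iff₀ hh]
      exact_mod_cast hs
    have h2 : ((⌈s / h⌉ - 1 : ℤ) : ℝ) ≤ k := by
      exact_mod_cast (by push_cast at h1; omega : ⌈s / h⌉ - 1 ≤ (k : ℤ))
    exact mul_le_mul_of_nonneg_right h2 hh.le

theorem measurable_gridFloor_aux (h : ℝ) : Measurable (gridFloor h) := by
  unfold gridFloor
  refine Measurable.ite measurableSet_Iic measurable_const ?_
  have h1 : Measurable (fun t : ℝ => ⌈t / h⌉) := Int.measurable_ceil.comp (measurable_id.div_const h)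
  have h2 : Measurable (fun m : ℤ => (↑(m - 1) : ℝ) * h) := measurable_from_top
  exact h2.comp h1

theorem gridFloor_integrable_aux {T h t : ℝ} (hT : 0 < T) (hh : 0 < h) (ht : t ∈ Set.Icc 0 T)
    {F : ℝ → ℝ} (hF : ContinuousOn F (Set.Icc 0 T)) :
    IntervalIntegrable (fun s => F (gridFloor h s)) MeasureTheory.volume 0 t := by
  obtain ⟨C, hC⟩ := isCompact_Icc.exists_bound_of_continuousOn hF
  have hG : Continuous (Set.IccExtend hT.le (Set.domRestrict (Set.Icc 0 T) F)) :=
    (continuousOn_iff_continuous_domRestrict.mp hF).Icc_extend'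
  have hmeas := hG.measurable.comp (measurable_gridFloor_aux h)
  have heq : ∀ s ∈ Set.Ioc 0 t, gridFloor h s ∈ Set.Icc 0 T := fun s hs =>
    ⟨(gridFloor_mem_aux hh hs.1.le).1, ((gridFloor_mem_aux hh hs.1.le).2.trans hs.2).trans ht.2⟩
  rw [intervalIntegrable_iff_integrableOn_Ioc_of_le ht.1]
  refine MeasureTheory.Integrable.of_bound (C := C) ?_ ?_
  · refine (hmeas.aestronglyMeasurable).congr ?_
    filter_upwards [MeasureTheory.ae_restrict_mem measurableSet_Ioc] with s hs
    simp only [Function.comp]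
    rw [Set.IccExtend_of_mem _ _ (heq s hs)]
    rfl
  · filter_upwards [MeasureTheory.ae_restrict_mem measurableSet_Ioc] with s hs
    exact hC _ (heq s hs)

/-- Gronwall reduction for the Euler scheme.  If `X` solves the pathwise
additive-noise SDE `X(t) = X₀ + ∫_0^t a(X(s)) ds + σ B(t)` with `a` Lipschitz with
constant `L`, and `Y` is the continuous Euler interpolation
`Y(t) = X₀ + ∫_0^t a(Y(⌊s⌋)) ds + σ B(t)` on the grid of mesh `h = T/n`, then
`sup_{t∈[0,T]} |X(t) − Y(t)| ≤ e^{LT} sup_{t∈[0,T]} |∫_0^t (a(X(s)) − a(X(⌊s⌋))) ds|`. -/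
theorem euler_scheme_gronwall_reduction
    (T σ X₀ : ℝ) (n : ℕ) (hT : 0 < T) (hn : 0 < n) (h : ℝ) (hh : h = T / n)
    (B : ℝ → ℝ) (hB : ContinuousOn B (Set.Icc 0 T)) (hB0 : B 0 = 0)
    (a : ℝ → ℝ) (L : NNReal) (ha : LipschitzWith L a)
    (X Y : ℝ → ℝ)
    (hX : ContinuousOn X (Set.Icc 0 T)) (hY : ContinuousOn Y (Set.Icc 0 T))
    (hXeq : ∀ t ∈ Set.Icc (0:ℝ) T, X t = X₀ + (∫ s in (0:ℝ)..t, a (X s)) + σ * B t)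
    (hYeq : ∀ t ∈ Set.Icc (0:ℝ) T,
      Y t = X₀ + (∫ s in (0:ℝ)..t, a (Y (gridFloor h s))) + σ * B t) :
    sSup ((fun t => |X t - Y t|) '' Set.Icc (0:ℝ) T)
      ≤ Real.exp ((L : ℝ) * T) *
        sSup ((fun t => |∫ s in (0:ℝ)..t, (a (X s) - a (X (gridFloor h s)))|)
          '' Set.Icc (0:ℝ) T) := by
  have hh0 : 0 < h := by rw [hh]; positivity
  have haX : ContinuousOn (fun s => a (X s)) (Set.Icc 0 T) := ha.continuous.comp_continuousOn hX
  have haY : ContinuousOn (fun s => a (Y s)) (Set.Icc 0 T) := ha.continuous.comp_continuousOn hY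
  have iX : ∀ t ∈ Set.Icc (0:ℝ) T,
      IntervalIntegrable (fun s => a (X s)) MeasureTheory.volume 0 t := fun t ht =>
    (haX.mono (by rw [Set.uIcc_of_le ht.1]; exact Set.Icc_subset_Icc le_rfl ht.2)).intervalIntegrable
  have iXf : ∀ t ∈ Set.Icc (0:ℝ) T,
      IntervalIntegrable (fun s => a (X (gridFloor h s))) MeasureTheory.volume 0 t := fun t ht =>
    gridFloor_integrable_aux hT hh0 ht haX
  have iYf : ∀ t ∈ Set.Icc (0:ℝ) T,
      IntervalIntegrable (fun s => a (Y (gridFloor h s))) MeasureTheory.volume 0 t := fun t ht =>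
    gridFloor_integrable_aux hT hh0 ht haY
  have hTm : T ∈ Set.Icc (0:ℝ) T := ⟨hT.le, le_rfl⟩
  set S := (fun t => |∫ s in (0:ℝ)..t, (a (X s) - a (X (gridFloor h s)))|) '' Set.Icc (0:ℝ) T
    with hS
  have hbdd : BddAbove S := by
    refine isCompact_Icc.bddAbove_image (ContinuousOn.abs ?_)
    have := intervalIntegral.continuousOn_primitive_interval'
      ((iX T hTm).sub (iXf T hTm)) (Set.left_mem_uIcc)
    rwa [Set.uIcc_of_le hT.le] at this
  set M := sSup S with hM
  have hMle : ∀ t ∈ Set.Icc (0:ℝ) T,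
      |∫ s in (0:ℝ)..t, (a (X s) - a (X (gridFloor h s)))| ≤ M := fun t ht =>
    le_csSup hbdd ⟨t, ht, rfl⟩
  have hM0 : 0 ≤ M := (abs_nonneg _).trans (hMle T hTm)
  have hmain : ∀ t ∈ Set.Icc (0:ℝ) T, X t - Y t =
      (∫ s in (0:ℝ)..t, (a (X s) - a (X (gridFloor h s)))) +
      ∫ s in (0:ℝ)..t, (a (X (gridFloor h s)) - a (Y (gridFloor h s))) := by
    intro t ht
    rw [intervalIntegral.integral_sub (iX t ht) (iXf t ht),
      intervalIntegral.integral_sub (iXf t ht) (iYf t ht), hXeq t ht, hYeq t ht]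
    ring
  have hexp : ∀ t : ℝ, ∫ s in (0:ℝ)..t, (L:ℝ) * (M * Real.exp (L * s)) =
      M * Real.exp (L * t) - M := by
    intro t
    have hd : ∀ x ∈ Set.uIcc 0 t, HasDerivAt (fun s : ℝ => M * Real.exp (L * s))
        ((L:ℝ) * (M * Real.exp (L * x))) x := by
      intro x _
      have := ((((hasDerivAt_id x).const_mul (L:ℝ)).exp).const_mul M)
      have he : (L:ℝ) * (M * Real.exp (L * x)) = M * (Real.exp (L * id x) * (L * 1)) := by
        simp only [id]
        ring
      rw [he]
      exact this
    rw [intervalIntegral.integral_eq_sub_of_hasDerivAt hd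
      ((by fun_prop : Continuous fun s : ℝ => (L:ℝ) * (M * Real.exp (L * s))).intervalIntegrable _ _)]
    simp
  have hind : ∀ k : ℕ, ∀ t ∈ Set.Icc (0:ℝ) T, t ≤ k * h →
      |X t - Y t| ≤ M * Real.exp (L * t) := by
    intro k
    induction k with
    | zero =>
      intro t ht htk
      have ht0 : t = 0 := le_antisymm (by simpa using htk) ht.1
      subst ht0
      rw [hmain 0 ht]
      simpa using hM0
    | succ k ih =>
      intro t ht htk
      rw [hmain t ht]
      have h2 : ‖∫ s in (0:ℝ)..t, (a (X (gridFloor h s)) - a (Y (gridFloor h s)))‖ ≤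
          ∫ s in (0:ℝ)..t, (L:ℝ) * (M * Real.exp (L * s)) := by
        refine intervalIntegral.norm_integral_le_of_norm_le ht.1 ?_
          ((by fun_prop : Continuous fun s : ℝ =>
            (L:ℝ) * (M * Real.exp (L * s))).intervalIntegrable _ _)
        refine Filter.Eventually.of_forall fun s hs => ?_
        obtain ⟨g0, g1⟩ := gridFloor_mem_aux hh0 hs.1.le
        have g2 := gridFloor_le_aux k hh0 (hs.2.trans htk)
        have g3 := ih (gridFloor h s) ⟨g0, (g1.trans hs.2).trans ht.2⟩ g2
        have g4 := ha.dist_le_mul (X (gridFloor h s)) (Y (gridFloor h s))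
        rw [Real.dist_eq, Real.dist_eq] at g4
        rw [Real.norm_eq_abs]
        refine g4.trans (mul_le_mul_of_nonneg_left (g3.trans ?_) L.2)
        gcongr
      rw [hexp, Real.norm_eq_abs] at h2
      have h3 := hMle t ht
      exact (abs_add_le _ _).trans (by linarith)
  refine csSup_le ⟨_, 0, ⟨le_rfl, hT.le⟩, rfl⟩ ?_
  rintro _ ⟨t, ht, rfl⟩
  have hnh : (n:ℝ) * h = T := by
    rw [hh]; field_simp
  have := hind n t ht (by rw [hnh]; exact ht.2)
  refine this.trans ?_
  rw [mul_comm]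
  have := ht.2
  gcongr
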